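/- Let γ ≥ 2 be a countable ordinal and Σ a finite alphabet containing a letter 0. If there exists a Π⁰_γ-complete ω-language L ⊆ Σ^ω accepted by a real-time Büchi 1-counter automaton, then there exists an infinitary rational relation R ⊆ Γ^ω × Γ^ω (where Γ = Σ ∪ {A}) which, regarded as an ω-language over the product alphabet Γ × Γ, is Π⁰_γ-complete. -/

import Mathlib

universe u

/-- We equip `Option σ` (the alphabet `Γ = Σ ∪ {A}`, with `A = none`) with the
discrete topology. -/
instance instTopOption (σ : Type u) : TopologicalSpace (Option σ) := ⊥
instance instDiscreteOption (σ : Type u) : DiscreteTopology (Option σ) := ⟨rfl⟩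

/-- Auxiliary function for the coding map `h`: reads position `i` inside the
concatenation of the blocks `A·0^(n+1)·x(n), A·0^(n+2)·x(n+1), ...`. -/
def hAux {σ : Type u} (z : σ) (x : ℕ → σ) : ℕ → ℕ → Option σ
  | _, 0 => none
  | n, (i+1) =>
    if i + 1 ≤ n + 1 then some z
    else if i + 1 = n + 2 then some (x n)
    else hAux z x (n+1) (i + 1 - (n+3))
  termination_by n i => i
  decreasing_by omega

/-- The coding map `h : Σ^ω → Γ^ω`,
`h(x) = A·0·x(1)·A·0²·x(2)·A·0³·x(3)···A·0ⁿ·x(n)···` (ω-words indexed by `ℕ`). -/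
def hmap {σ : Type u} (z : σ) (x : ℕ → σ) : ℕ → Option σ := fun i => hAux z x 0 i

/-- Auxiliary function for the ω-word `α₀`. -/
def aAux {σ : Type u} (z : σ) : ℕ → ℕ → Option σ
  | _, 0 => none
  | n, (i+1) =>
    if i + 1 ≤ n + 1 then some z
    else aAux z (n+1) (i + 1 - (n+2))
  termination_by n i => i
  decreasing_by omega

/-- The ω-word `α₀ = A·0·A·0²·A·0³···A·0ⁿ···` over `Γ = Σ ∪ {A}`. -/
def alphaWord {σ : Type u} (z : σ) : ℕ → Option σ := fun i => aAux z 0 i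

/-- The Borel hierarchy on a topological space `X`: `SigmaPi X α true` is the class
`Σ⁰_α` and `SigmaPi X α false` is the class `Π⁰_α`.  `Σ⁰_1` is the class of open
sets, `Π⁰_1` is the class of closed sets, and for `α ≥ 2`, `Σ⁰_α` (resp. `Π⁰_α`)
is the class of countable unions (resp. intersections) of sets in
`⋃_{γ < α} Π⁰_γ` (resp. `⋃_{γ < α} Σ⁰_γ`). -/
def SigmaPi (X : Type u) [TopologicalSpace X] (α : Ordinal.{0}) (b : Bool) : Set (Set X) :=
  {s | (α = 1 ∧ ((b = true ∧ IsOpen s) ∨ (b = false ∧ IsClosed s)))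
    ∨ (α ≠ 1 ∧ ∃ f : ℕ → Set X,
        (∀ n : ℕ, ∃ γ : Ordinal.{0}, ∃ _ : γ < α, f n ∈ SigmaPi X γ !b) ∧
        s = if b then ⋃ n, f n else ⋂ n, f n)}
  termination_by α
  decreasing_by assumption

/-- The class `Σ⁰_α` of the Borel hierarchy on `X`. -/
abbrev Sigma0 (X : Type u) [TopologicalSpace X] (α : Ordinal.{0}) : Set (Set X) :=
  SigmaPi X α true

/-- The class `Π⁰_α` of the Borel hierarchy on `X`. -/
abbrev Pi0 (X : Type u) [TopologicalSpace X] (α : Ordinal.{0}) : Set (Set X) :=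
  SigmaPi X α false

/-- `F ⊆ Σ^ω` is `Σ⁰_α`-complete (for `b = true`), resp. `Π⁰_α`-complete (for
`b = false`), iff for every nonempty finite alphabet `Y` and every `E ⊆ Y^ω`
(with `Y^ω` carrying the Cantor topology, i.e. the product of the discrete
topology): `E ∈ Σ⁰_α` (resp. `Π⁰_α`) iff `E = f⁻¹(F)` for some continuous
`f : Y^ω → Σ^ω`. -/
def IsCompleteFor (b : Bool) (α : Ordinal.{0}) {σ : Type} [TopologicalSpace σ]
    (F : Set (ℕ → σ)) : Prop :=
  ∀ (Y : Type), Fintype Y → Nonempty Y → ∀ E : Set (ℕ → Y),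
    letI : TopologicalSpace Y := ⊥
    (E ∈ SigmaPi (ℕ → Y) α b ↔
      ∃ f : (ℕ → Y) → (ℕ → σ), Continuous f ∧ E = f ⁻¹' F)

/-- The infinite concatenation of the finite words `u 0, u 1, u 2, ...` equals the
ω-word `x`: every finite partial concatenation is a prefix of `x`, and the total
length is infinite. -/
def JoinsTo {α : Type u} (u : ℕ → List α) (x : ℕ → α) : Prop :=
  (∀ N : ℕ, ∃ n : ℕ, N ≤ (((List.range n).map u).flatten).length) ∧
  (∀ (n i : ℕ) (h : i < (((List.range n).map u).flatten).length),
      (((List.range n).map u).flatten)[i]'h = x i)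

/-- A 2-tape Büchi automaton with input alphabet `σ` and output alphabet `γ`:
a finite set of states `Q`, a finite set `trans ⊆ Q × σ^⋆ × γ^⋆ × Q` of
transitions, an initial state `init` and a set `acc` of accepting states. -/
structure TwoTapeBuchi (σ γ : Type u) where
  Q : Type u
  finQ : Finite Q
  trans : Set (Q × List σ × List γ × Q)
  finTrans : trans.Finite
  init : Q
  acc : Set Q

/-- The pair `(x, y)` of ω-words is accepted by the 2-tape Büchi automaton `T`
iff it is the pair of input and output words of some successful computation. -/
def TwoTapeBuchi.Accepts {σ γ : Type u} (T : TwoTapeBuchi σ γ)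
    (x : ℕ → σ) (y : ℕ → γ) : Prop :=
  ∃ (q : ℕ → T.Q) (u : ℕ → List σ) (v : ℕ → List γ),
    q 0 = T.init ∧
    (∀ n : ℕ, (q n, u n, v n, q (n+1)) ∈ T.trans) ∧
    (∃ qf ∈ T.acc, ∀ n : ℕ, ∃ m : ℕ, n ≤ m ∧ q m = qf) ∧
    JoinsTo u x ∧ JoinsTo v y

/-- `R ⊆ Σ^ω × Γ^ω` is an infinitary rational relation iff it is the relation
accepted by some 2-tape Büchi automaton. -/
def IsRatRel {σ γ : Type u} (R : Set ((ℕ → σ) × (ℕ → γ))) : Prop :=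
  ∃ T : TwoTapeBuchi σ γ, ∀ p : (ℕ → σ) × (ℕ → γ), p ∈ R ↔ T.Accepts p.1 p.2

/-- A real-time Büchi 1-counter automaton: transitions are in
`Q × σ × Bool × Q × ℤ` with the counter move in `{-1, 0, 1}`, and a zero test
(`false` means the counter is zero) which forbids decrementing a zero counter. -/
structure OneCounterBuchi (σ : Type u) where
  Q : Type u
  finQ : Finite Q
  trans : Set (Q × σ × Bool × Q × ℤ)
  transMoves : ∀ t ∈ trans, t.2.2.2.2 = -1 ∨ t.2.2.2.2 = 0 ∨ t.2.2.2.2 = 1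
  transZero : ∀ t ∈ trans, t.2.2.1 = false → t.2.2.2.2 = 0 ∨ t.2.2.2.2 = 1
  init : Q
  acc : Set Q

/-- One computation step of a 1-counter automaton on letter `a`, from
configuration `p` to configuration `p'`. -/
def OneCounterBuchi.Step {σ : Type u} (M : OneCounterBuchi σ) (a : σ)
    (p p' : M.Q × ℕ) : Prop :=
  ∃ j : ℤ, (p.1, a, (p.2 ≠ 0 : Bool), p'.1, j) ∈ M.trans ∧ (p'.2 : ℤ) = (p.2 : ℤ) + j

/-- The ω-word `x` is accepted by the real-time Büchi 1-counter automaton `M`: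
there is a run on `x` starting in `(q₀, 0)` in which some accepting state occurs
infinitely often. -/
def OneCounterBuchi.Accepts {σ : Type u} (M : OneCounterBuchi σ) (x : ℕ → σ) : Prop :=
  ∃ r : ℕ → M.Q × ℕ,
    r 0 = (M.init, 0) ∧
    (∀ i : ℕ, M.Step (x i) (r i) (r (i+1))) ∧
    ∃ qf ∈ M.acc, ∀ n : ℕ, ∃ m : ℕ, n ≤ m ∧ (r m).1 = qf

/-- The identification of a pair of ω-words with an ω-word over the product
alphabet. -/
def pairToWord {a b : Type u} (p : (ℕ → a) × (ℕ → b)) : ℕ → a × b :=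
  fun n => (p.1 n, p.2 n)

/-! ### Semantics of 2-tape automata through head positions -/

def seg {α : Type u} (x : ℕ → α) (i k : ℕ) : List α := (List.range k).map (fun t => x (i + t))

@[simp] lemma seg_length {α : Type u} (x : ℕ → α) (i k : ℕ) : (seg x i k).length = k := by
  simp [seg]

lemma seg_add {α : Type u} (x : ℕ → α) (a b : ℕ) : seg x 0 (a + b) = seg x 0 a ++ seg x a b := by
  simp [seg, List.range_add, Function.comp_def]

@[simp] lemma seg_zero {α : Type u} (x : ℕ → α) (i : ℕ) : seg x i 0 = [] := rfl
@[simp] lemma seg_one {α : Type u} (x : ℕ → α) (i : ℕ) : seg x i 1 = [x i] := rfl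
@[simp] lemma seg_two {α : Type u} (x : ℕ → α) (i : ℕ) : seg x i 2 = [x i, x (i+1)] := rfl

lemma joinsTo_iff {α : Type u} (u : ℕ → List α) (x : ℕ → α) :
    JoinsTo u x ↔ ∃ i : ℕ → ℕ, i 0 = 0 ∧
      (∀ n, u n = seg x (i n) (u n).length ∧ i (n+1) = i n + (u n).length) ∧
      ∀ N, ∃ n, N ≤ i n := by
  constructor
  · rintro ⟨h1, h2⟩
    refine ⟨fun n => (((List.range n).map u).flatten).length, by simp, ?_, h1⟩
    intro n
    have hs : ((List.range (n+1)).map u).flatten = ((List.range n).map u).flatten ++ u n := by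
      simp [List.range_succ]
    refine ⟨?_, by simp only [hs, List.length_append]⟩
    apply List.ext_getElem
    · simp
    · intro t ht ht'
      have hlt : (((List.range n).map u).flatten).length + t
          < (((List.range (n+1)).map u).flatten).length := by
        rw [hs, List.length_append]; omega
      have := h2 (n+1) _ hlt
      simp only [seg, List.getElem_map, List.getElem_range]
      rw [← this]
      simp only [hs]
      rw [List.getElem_append_right (by omega)]
      simp
  · rintro ⟨i, h0, hs, hN⟩
    have key : ∀ n, ((List.range n).map u).flatten = seg x 0 (i n) := by
      intro n
      induction n with
      | zero => simp [h0]
      | succ n ih =>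
        rw [(hs n).2, seg_add, ← (hs n).1, ← ih]
        simp [List.range_succ]
    refine ⟨?_, ?_⟩
    · intro N
      obtain ⟨n, hn⟩ := hN N
      exact ⟨n, by rw [key]; simpa using hn⟩
    · intro n t ht
      simp only [key]
      simp [seg]

/-- Steps between configurations (state, position of head 1, position of head 2). -/
def TwoTapeBuchi.StepC {σ γ : Type u} (T : TwoTapeBuchi σ γ) (x : ℕ → σ) (y : ℕ → γ)
    (c c' : T.Q × ℕ × ℕ) : Prop :=
  ∃ u v, (c.1, u, v, c'.1) ∈ T.trans ∧ u = seg x c.2.1 u.length ∧ c'.2.1 = c.2.1 + u.length ∧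
    v = seg y c.2.2 v.length ∧ c'.2.2 = c.2.2 + v.length

def TwoTapeBuchi.AccFrom {σ γ : Type u} (T : TwoTapeBuchi σ γ) (x : ℕ → σ) (y : ℕ → γ)
    (c : T.Q × ℕ × ℕ) : Prop :=
  ∃ ρ : ℕ → T.Q × ℕ × ℕ, ρ 0 = c ∧ (∀ n, T.StepC x y (ρ n) (ρ (n+1))) ∧
    (∃ qf ∈ T.acc, ∀ n : ℕ, ∃ m : ℕ, n ≤ m ∧ (ρ m).1 = qf) ∧
    (∀ N, ∃ n, N ≤ (ρ n).2.1) ∧ (∀ N, ∃ n, N ≤ (ρ n).2.2)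

lemma TwoTapeBuchi.accepts_iff {σ γ : Type u} (T : TwoTapeBuchi σ γ) (x : ℕ → σ) (y : ℕ → γ) :
    T.Accepts x y ↔ T.AccFrom x y (T.init, 0, 0) := by
  constructor
  · rintro ⟨q, u, v, h0, ht, hacc, hu, hv⟩
    obtain ⟨i, hi0, hi, hiN⟩ := (joinsTo_iff _ _).1 hu
    obtain ⟨j, hj0, hj, hjN⟩ := (joinsTo_iff _ _).1 hv
    exact ⟨fun n => (q n, i n, j n), by simp [h0, hi0, hj0],
      fun n => ⟨u n, v n, ht n, (hi n).1, (hi n).2, (hj n).1, (hj n).2⟩, hacc, hiN, hjN⟩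
  · rintro ⟨ρ, h0, hs, hacc, hiN, hjN⟩
    choose u v ht hu hi hv hj using hs
    refine ⟨fun n => (ρ n).1, u, v, by simp [h0], ht, hacc, ?_, ?_⟩
    · exact (joinsTo_iff _ _).2 ⟨fun n => (ρ n).2.1, by simp [h0], fun n => ⟨hu n, hi n⟩, hiN⟩
    · exact (joinsTo_iff _ _).2 ⟨fun n => (ρ n).2.2, by simp [h0], fun n => ⟨hv n, hj n⟩, hjN⟩

lemma TwoTapeBuchi.AccFrom.tail {σ γ : Type u} {T : TwoTapeBuchi σ γ} {x : ℕ → σ} {y : ℕ → γ}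
    {c : T.Q × ℕ × ℕ} (h : T.AccFrom x y c) : ∃ c', T.StepC x y c c' ∧ T.AccFrom x y c' := by
  obtain ⟨ρ, h0, hs, ⟨qf, hqf, hacc⟩, hi, hj⟩ := h
  refine ⟨ρ 1, h0 ▸ hs 0, fun n => ρ (n+1), rfl, fun n => hs (n+1), ⟨qf, hqf, ?_⟩, ?_, ?_⟩
  · intro n
    obtain ⟨m, hm, hq⟩ := hacc (n+1)
    obtain ⟨m, rfl⟩ : ∃ k, m = k + 1 := ⟨m - 1, by omega⟩
    exact ⟨m, by omega, hq⟩
  · intro N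
    obtain ⟨n, hn⟩ := hi N
    obtain ⟨u, v, _, _, h, _⟩ := hs n
    exact ⟨n, by simp only; omega⟩
  · intro N
    obtain ⟨n, hn⟩ := hj N
    obtain ⟨u, v, _, _, _, _, h⟩ := hs n
    exact ⟨n, by simp only; omega⟩

lemma TwoTapeBuchi.AccFrom.cons {σ γ : Type u} {T : TwoTapeBuchi σ γ} {x : ℕ → σ} {y : ℕ → γ}
    {c c' : T.Q × ℕ × ℕ} (h : T.AccFrom x y c') (hst : T.StepC x y c c') : T.AccFrom x y c := by
  obtain ⟨ρ, h0, hs, ⟨qf, hqf, hacc⟩, hi, hj⟩ := h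
  refine ⟨fun n => Nat.casesOn n c ρ, rfl, ?_, ⟨qf, hqf, ?_⟩, ?_, ?_⟩
  · intro n
    cases n with
    | zero => simpa [h0] using hst
    | succ n => exact hs n
  · intro n
    obtain ⟨m, hm, hq⟩ := hacc n
    exact ⟨m+1, by omega, hq⟩
  · intro N
    obtain ⟨n, hn⟩ := hi N
    exact ⟨n+1, hn⟩
  · intro N
    obtain ⟨n, hn⟩ := hj N
    exact ⟨n+1, hn⟩

/-! ### The automaton -/

inductive St (Q : Type u) : Type u
  | start | chk1 | chk2 | sink
  | sim (q : Q)

instance St.finite {Q : Type u} [Finite Q] : Finite (St Q) := by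
  refine Finite.of_surjective
    (fun o : Q ⊕ Fin 4 => match o with
      | Sum.inl q => St.sim q
      | Sum.inr 0 => St.start
      | Sum.inr 1 => St.chk1
      | Sum.inr 2 => St.chk2
      | Sum.inr 3 => St.sink) ?_
  rintro (_ | _ | _ | _ | q)
  · exact ⟨Sum.inr 0, rfl⟩
  · exact ⟨Sum.inr 1, rfl⟩
  · exact ⟨Sum.inr 2, rfl⟩
  · exact ⟨Sum.inr 3, rfl⟩
  · exact ⟨Sum.inl q, rfl⟩

/-- Transitions. -/
inductive Tr {σ : Type u} (M : OneCounterBuchi σ) :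
    St M.Q → List (Option σ) → List (Option σ) → St M.Q → Prop
  | toSim : Tr M .start [] [] (.sim M.init)
  | toChk1 : Tr M .start [] [] .chk1
  | toChk2 (b c) : Tr M .start [] [b, c] .chk2
  | bad0 (b c) (h : ¬ (b ≠ none ∧ c = none)) : Tr M .start [] [b, c] .sink
  | loop1 (a b) : Tr M .chk1 [a] [b] .chk1
  | bad1 (a b) (h : ¬ (a ≠ none ↔ b ≠ none)) : Tr M .chk1 [a] [b] .sink
  | loop2 (a b c) : Tr M .chk2 [a] [b, c] .chk2
  | bad2 (a b c) (h : ¬ ((a ≠ none ↔ b ≠ none) ∧ c = none)) : Tr M .chk2 [a] [b, c] .sink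
  | sink (a b) : Tr M .sink [a] [b] .sink
  | idle (q b) : Tr M (.sim q) [none] [b] (.sim q)
  | keep (q q' a b) (h : (q, a, b.isNone, q', (0 : ℤ)) ∈ M.trans) :
      Tr M (.sim q) [some a] [b] (.sim q')
  | inc (q q' a b d) (h : (q, a, b.isNone, q', (1 : ℤ)) ∈ M.trans) :
      Tr M (.sim q) [some a, d] [b] (.sim q')
  | dec (q q' a b d) (h : (q, a, b.isNone, q', (-1 : ℤ)) ∈ M.trans) :
      Tr M (.sim q) [some a] [b, d] (.sim q')

def autT {σ : Type u} [Finite σ] (M : OneCounterBuchi σ) :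
    TwoTapeBuchi (Option σ) (Option σ) where
  Q := St M.Q
  finQ := by
    haveI := M.finQ
    infer_instance
  trans := {t | Tr M t.1 t.2.1 t.2.2.1 t.2.2.2}
  finTrans := by
    haveI := M.finQ
    have hl : {l : List (Option σ) | l.length ≤ 2}.Finite := List.finite_length_le _ _
    refine Set.Finite.subset
      ((Set.finite_univ (α := St M.Q)).prod (hl.prod (hl.prod (Set.finite_univ (α := St M.Q))))) ?_
    rintro ⟨q, u, v, q'⟩ h
    simp only [Set.mem_setOf_eq] at h
    simp only [Set.mem_prod, Set.mem_univ, Set.mem_setOf_eq, true_and, and_true]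
    cases h <;> simp
  init := .start
  acc := {s | s = .sink ∨ ∃ q ∈ M.acc, s = .sim q}

/-- The same steps, in terms of configurations. -/
inductive CStep {σ : Type u} (M : OneCounterBuchi σ) (x y : ℕ → Option σ) :
    St M.Q × ℕ × ℕ → St M.Q × ℕ × ℕ → Prop
  | toSim (i j) : CStep M x y (.start, i, j) (.sim M.init, i, j)
  | toChk1 (i j) : CStep M x y (.start, i, j) (.chk1, i, j)
  | toChk2 (i j) : CStep M x y (.start, i, j) (.chk2, i, j + 2)
  | bad0 (i j) (h : ¬ (y j ≠ none ∧ y (j+1) = none)) :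
      CStep M x y (.start, i, j) (.sink, i, j + 2)
  | loop1 (i j) : CStep M x y (.chk1, i, j) (.chk1, i + 1, j + 1)
  | bad1 (i j) (h : ¬ (x i ≠ none ↔ y j ≠ none)) :
      CStep M x y (.chk1, i, j) (.sink, i + 1, j + 1)
  | loop2 (i j) : CStep M x y (.chk2, i, j) (.chk2, i + 1, j + 2)
  | bad2 (i j) (h : ¬ ((x i ≠ none ↔ y j ≠ none) ∧ y (j+1) = none)) :
      CStep M x y (.chk2, i, j) (.sink, i + 1, j + 2)
  | sink (i j) : CStep M x y (.sink, i, j) (.sink, i + 1, j + 1)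
  | idle (i j q) (h : x i = none) : CStep M x y (.sim q, i, j) (.sim q, i + 1, j + 1)
  | keep (i j q q' a) (hx : x i = some a) (h : (q, a, (y j).isNone, q', (0 : ℤ)) ∈ M.trans) :
      CStep M x y (.sim q, i, j) (.sim q', i + 1, j + 1)
  | inc (i j q q' a) (hx : x i = some a) (h : (q, a, (y j).isNone, q', (1 : ℤ)) ∈ M.trans) :
      CStep M x y (.sim q, i, j) (.sim q', i + 2, j + 1)
  | dec (i j q q' a) (hx : x i = some a) (h : (q, a, (y j).isNone, q', (-1 : ℤ)) ∈ M.trans) :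
      CStep M x y (.sim q, i, j) (.sim q', i + 1, j + 2)

lemma stepC_of_cstep {σ : Type u} [Finite σ] (M : OneCounterBuchi σ) (x y : ℕ → Option σ)
    (c c' : St M.Q × ℕ × ℕ) (h : CStep M x y c c') : (autT M).StepC x y c c' := by
  cases h with
  | toSim i j => exact ⟨[], [], Tr.toSim, by simp⟩
  | toChk1 i j => exact ⟨[], [], Tr.toChk1, by simp⟩
  | toChk2 i j => exact ⟨[], [y j, y (j+1)], Tr.toChk2 _ _, by simp⟩
  | bad0 i j h => exact ⟨[], [y j, y (j+1)], Tr.bad0 _ _ h, by simp⟩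
  | loop1 i j => exact ⟨[x i], [y j], Tr.loop1 _ _, by simp⟩
  | bad1 i j h => exact ⟨[x i], [y j], Tr.bad1 _ _ h, by simp⟩
  | loop2 i j => exact ⟨[x i], [y j, y (j+1)], Tr.loop2 _ _ _, by simp⟩
  | bad2 i j h => exact ⟨[x i], [y j, y (j+1)], Tr.bad2 _ _ _ h, by simp⟩
  | sink i j => exact ⟨[x i], [y j], Tr.sink _ _, by simp⟩
  | idle i j q h => exact ⟨[none], [y j], Tr.idle _ _, by simp [h]⟩
  | keep i j q q' a hx h => exact ⟨[some a], [y j], Tr.keep _ _ _ _ h, by simp [hx]⟩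
  | inc i j q q' a hx h => exact ⟨[some a, x (i+1)], [y j], Tr.inc _ _ _ _ _ h, by simp [hx]⟩
  | dec i j q q' a hx h => exact ⟨[some a], [y j, y (j+1)], Tr.dec _ _ _ _ _ h, by simp [hx]⟩

lemma cstep_of_stepC {σ : Type u} [Finite σ] (M : OneCounterBuchi σ) (x y : ℕ → Option σ)
    (c c' : St M.Q × ℕ × ℕ) (h : (autT M).StepC x y c c') : CStep M x y c c' := by
  obtain ⟨s, i, j⟩ := c
  obtain ⟨s', i', j'⟩ := c'
  obtain ⟨u, v, ht, hu, hi, hv, hj⟩ := h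
  change Tr M s u v s' at ht
  dsimp only at hu hi hv hj
  subst hi hj
  cases ht with
  | toSim => exact CStep.toSim _ _
  | toChk1 => exact CStep.toChk1 _ _
  | toChk2 b c => exact CStep.toChk2 _ _
  | bad0 b c h =>
    simp at hv
    exact CStep.bad0 _ _ (by rw [← hv.1, ← hv.2]; exact h)
  | loop1 a b => exact CStep.loop1 _ _
  | bad1 a b h =>
    simp at hu hv
    exact CStep.bad1 _ _ (by rw [← hu, ← hv]; exact h)
  | loop2 a b c => exact CStep.loop2 _ _
  | bad2 a b c h =>
    simp at hu hv
    exact CStep.bad2 _ _ (by rw [← hu, ← hv.1, ← hv.2]; exact h)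
  | sink a b => exact CStep.sink _ _
  | idle q b =>
    simp at hu
    exact CStep.idle _ _ _ hu.symm
  | keep q q' a b h =>
    simp at hu hv
    exact CStep.keep _ _ _ _ a hu.symm (by rw [← hv]; exact h)
  | inc q q' a b d h =>
    simp at hu hv
    exact CStep.inc _ _ _ _ a hu.1.symm (by rw [← hv]; exact h)
  | dec q q' a b d h =>
    simp at hu hv
    exact CStep.dec _ _ _ _ a hu.symm (by rw [← hv.1]; exact h)

/-! ### The code set -/

def Good {α : Type u} (x y : ℕ → Option α) : Prop :=
  (y 0 ≠ none ∧ y 1 = none) ∧ (∀ i, x i ≠ none ↔ y i ≠ none) ∧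
    ∀ i, (x i ≠ none ↔ y (2*i+2) ≠ none) ∧ y (2*i+2+1) = none

lemma accFrom_sink {σ : Type u} [Finite σ] (M : OneCounterBuchi σ) (x y : ℕ → Option σ)
    (i j : ℕ) : (autT M).AccFrom x y (St.sink, i, j) := by
  refine ⟨fun n => (St.sink, i + n, j + n), rfl, fun n => stepC_of_cstep _ _ _ _ _ (CStep.sink _ _),
    ⟨St.sink, Or.inl rfl, fun n => ⟨n, le_rfl, rfl⟩⟩, fun N => ⟨N, ?_⟩, fun N => ⟨N, ?_⟩⟩
  · simp
  · simp

lemma accepts_of_not_good {σ : Type u} [Finite σ] (M : OneCounterBuchi σ) (x y : ℕ → Option σ)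
    (h : ¬ Good x y) : (autT M).Accepts x y := by
  rw [TwoTapeBuchi.accepts_iff]
  change (autT M).AccFrom x y (St.start, 0, 0)
  by_cases h0 : y 0 ≠ none ∧ y 1 = none
  · by_cases h1 : ∀ i, x i ≠ none ↔ y i ≠ none
    · have h2 : ∃ i, ¬ ((x i ≠ none ↔ y (2*i+2) ≠ none) ∧ y (2*i+2+1) = none) := by
        by_contra hc
        push Not at hc
        exact h ⟨h0, h1, fun i => by have := hc i; tauto⟩
      obtain ⟨k, hk⟩ := h2
      refine TwoTapeBuchi.AccFrom.cons ?_ (stepC_of_cstep _ _ _ _ _ (CStep.toChk2 0 0))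
      have : ∀ k, (autT M).AccFrom x y (St.chk2, k, 2*k+2) →
          (autT M).AccFrom x y (St.chk2, 0, 0+2) := by
        intro k
        induction k with
        | zero => exact id
        | succ k ih =>
          intro hh
          exact ih (hh.cons (stepC_of_cstep _ _ _ _ _ (CStep.loop2 k (2*k+2))))
      exact this k ((accFrom_sink M x y _ _).cons (stepC_of_cstep _ _ _ _ _ (CStep.bad2 _ _ hk)))
    · push Not at h1
      obtain ⟨k, hk⟩ := h1
      replace hk : ¬ (x k ≠ none ↔ y k ≠ none) := by tauto
      refine TwoTapeBuchi.AccFrom.cons ?_ (stepC_of_cstep _ _ _ _ _ (CStep.toChk1 0 0))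
      have : ∀ k, (autT M).AccFrom x y (St.chk1, k, k) →
          (autT M).AccFrom x y (St.chk1, 0, 0) := by
        intro k
        induction k with
        | zero => exact id
        | succ k ih =>
          intro hh
          exact ih (hh.cons (stepC_of_cstep _ _ _ _ _ (CStep.loop1 k k)))
      exact this k ((accFrom_sink M x y _ _).cons (stepC_of_cstep _ _ _ _ _ (CStep.bad1 _ _ hk)))
  · exact (accFrom_sink M x y _ _).cons (stepC_of_cstep _ _ _ _ _ (CStep.bad0 0 0 h0))

/-! ### Marker positions -/

def mk (n : ℕ) : ℕ := 2 ^ (n+1) - 2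

lemma mk_succ (n : ℕ) : mk (n+1) = 2 * mk n + 2 := by
  have := Nat.one_le_two_pow (n := n)
  simp only [mk, pow_succ]; omega

lemma mk_zero : mk 0 = 0 := rfl

lemma le_mk (n : ℕ) : n ≤ mk n := by
  induction n with
  | zero => simp
  | succ n ih => rw [mk_succ]; omega

lemma mk_strictMono : StrictMono mk := strictMono_nat_of_lt_succ (fun n => by rw [mk_succ]; omega)

/-- index of the next marker at or after position `i` -/
noncomputable def nx (i : ℕ) : ℕ := by
  classical exact Nat.find (p := fun k => i ≤ mk k) ⟨i, le_mk i⟩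

lemma le_mk_nx (i : ℕ) : i ≤ mk (nx i) := by
  classical
  unfold nx
  exact Nat.find_spec (p := fun k => i ≤ mk k) _

lemma nx_le {i k : ℕ} (h : i ≤ mk k) : nx i ≤ k := by
  classical
  unfold nx
  exact Nat.find_min' (p := fun k => i ≤ mk k) _ h

lemma nx_mk (k : ℕ) : nx (mk k) = k :=
  le_antisymm (nx_le le_rfl) (mk_strictMono.le_iff_le.1 (le_mk_nx _))

lemma nx_mono {i j : ℕ} (h : i ≤ j) : nx i ≤ nx j := nx_le (h.trans (le_mk_nx j))

lemma nx_succ {i : ℕ} (h : i ≠ mk (nx i)) : nx (i+1) = nx i :=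
  le_antisymm (nx_le (by have := le_mk_nx i; omega)) (nx_mono (by omega))

lemma lt_nx {i k : ℕ} (h : mk k < i) : k < nx i :=
  mk_strictMono.lt_iff_lt.1 (h.trans_le (le_mk_nx i))

lemma nx_mk_add_one (k : ℕ) : nx (mk k + 1) = k + 1 :=
  le_antisymm (nx_le (by rw [mk_succ]; omega)) (lt_nx (by omega))

lemma nx_mk_add_two (k : ℕ) : nx (mk k + 2) = k + 1 :=
  le_antisymm (nx_le (by rw [mk_succ]; omega)) (lt_nx (by omega))

lemma nx_zero : nx 0 = 0 := nx_mk 0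

lemma Good.marker {α : Type u} {x y : ℕ → Option α} (h : Good x y) (p : ℕ) :
    y p ≠ none ↔ p ∈ Set.range mk := by
  obtain ⟨⟨h0, h1⟩, h2, h3⟩ := h
  induction p using Nat.strong_induction_on with
  | _ p ih =>
    rcases Nat.even_or_odd' p with ⟨c, rfl | rfl⟩
    · rcases c with _ | c
      · simp only [Nat.mul_zero]
        exact ⟨fun _ => ⟨0, rfl⟩, fun _ => h0⟩
      · have e : 2 * (c + 1) = 2 * c + 2 := by ring
        rw [e, ← (h3 c).1, h2 c, ih c (by omega)]
        constructor
        · rintro ⟨n, rfl⟩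
          exact ⟨n+1, mk_succ n⟩
        · rintro ⟨n, hn⟩
          cases n with
          | zero => rw [mk_zero] at hn; omega
          | succ n => rw [mk_succ] at hn; exact ⟨n, by omega⟩
    · have hy : y (2 * c + 1) = none := by
        rcases c with _ | c
        · exact h1
        · exact (h3 c).2
      simp only [hy, ne_eq, not_true_eq_false, false_iff]
      rintro ⟨n, hn⟩
      cases n with
      | zero => rw [mk_zero] at hn; omega
      | succ n => rw [mk_succ] at hn; omega

lemma Good.marker_x {α : Type u} {x y : ℕ → Option α} (h : Good x y) (p : ℕ) :
    x p ≠ none ↔ p ∈ Set.range mk := by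
  rw [h.2.1 p, h.marker p]

lemma mk_sub {k k' c : ℕ} (hc : c ≤ k) (h : mk k = mk k' + c) : c = 0 := by
  rcases lt_trichotomy k k' with hlt | rfl | hlt
  · have := mk_strictMono hlt; omega
  · omega
  · obtain ⟨k, rfl⟩ : ∃ l, k = l + 1 := ⟨k - 1, by omega⟩
    have h1 := mk_strictMono.monotone (show k' ≤ k by omega)
    rw [mk_succ] at h
    have := le_mk k
    omega

/-- zero test -/
lemma Good.test {α : Type u} {x y : ℕ → Option α} (h : Good x y) {k j c : ℕ} (hc : c ≤ k)
    (hj : mk k = j + c) : (y j).isNone = (decide (c ≠ 0)) := by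
  have hm := h.marker j
  by_cases h0 : c = 0
  · subst h0
    have : y j ≠ none := hm.2 ⟨k, by omega⟩
    cases hy : y j with
    | none => exact absurd hy this
    | some a => simp
  · have : y j = none := by
      by_contra hne
      obtain ⟨k', rfl⟩ := hm.1 hne
      exact h0 (mk_sub hc hj)
    simp [this, h0]

/-! ### Stuttering -/

lemma reach {k : ℕ → ℕ} (h0 : k 0 = 0) (hs : ∀ n, k (n+1) = k n ∨ k (n+1) = k n + 1)
    (hN : ∀ N, ∃ n, N ≤ k n) (m : ℕ) : ∃ n, k n = m ∧ k (n+1) = m + 1 := by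
  classical
  have hex : ∃ n, m + 1 ≤ k n := hN (m+1)
  have h1 := Nat.find_spec hex
  have h2 := fun l hl => Nat.find_min hex (m := l) hl
  set n := Nat.find hex
  cases hn : n with
  | zero => rw [hn, h0] at h1; omega
  | succ l =>
    have := h2 l (by omega)
    rw [hn] at h1
    refine ⟨l, ?_⟩
    rcases hs l with h | h <;> omega

lemma stutter {C : Type u} {P : ℕ → C → C → Prop} {k : ℕ → ℕ} {R : ℕ → C} (h0 : k 0 = 0)
    (hs : ∀ n, (k (n+1) = k n ∧ R (n+1) = R n) ∨ (k (n+1) = k n + 1 ∧ P (k n) (R n) (R (n+1))))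
    (hN : ∀ N, ∃ n, N ≤ k n) :
    ∃ r : ℕ → C, (∀ n, r (k n) = R n) ∧ ∀ m, P m (r m) (r (m+1)) := by
  have hs' : ∀ n, k (n+1) = k n ∨ k (n+1) = k n + 1 := fun n => (hs n).imp And.left And.left
  have hmono : Monotone k := monotone_nat_of_le_succ (fun n => by rcases hs' n with h | h <;> omega)
  have hconst : ∀ n d, k (n+d) = k n → R (n+d) = R n := by
    intro n d
    induction d with
    | zero => simp
    | succ d ih =>
      intro h
      have a1 := hmono (show n ≤ n + d by omega)
      have a2 := hmono (show n + d ≤ n + (d + 1) by omega)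
      rcases hs (n+d) with h' | h'
      · rw [← ih (by omega), ← h'.2]; rfl
      · have : k (n + (d+1)) = k (n + d) + 1 := h'.1
        omega
  have hconst' : ∀ n n', k n = k n' → R n = R n' := by
    intro n n' h
    rcases le_total n n' with hl | hl
    · obtain ⟨d, rfl⟩ := Nat.exists_eq_add_of_le hl
      exact (hconst _ _ h.symm).symm
    · obtain ⟨d, rfl⟩ := Nat.exists_eq_add_of_le hl
      exact hconst _ _ h
  choose t ht ht' using reach h0 hs' hN
  refine ⟨fun m => R (t m), fun n => hconst' _ _ (ht _), fun m => ?_⟩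
  rcases hs (t m) with h | h
  · have := ht m; have := ht' m; omega
  · have h2 := h.2
    rw [ht m] at h2
    simp only
    rwa [hconst' (t (m+1)) (t m + 1) (by rw [ht, ht'])]

/-! ### Correctness of the simulation -/

lemma good_x {σ : Type u} {x y : ℕ → Option σ} (h : Good x y) (z : σ) (k : ℕ) :
    x (mk k) = some ((x (mk k)).getD z) := by
  have := (h.marker_x (mk k)).2 ⟨k, rfl⟩
  cases hx : x (mk k) with
  | none => exact absurd hx this
  | some a => rfl

/-- One simulated step, analysed. -/
lemma sim_step {σ : Type u} {M : OneCounterBuchi σ} {x y : ℕ → Option σ} (h : Good x y) (z : σ)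
    {q : M.Q} {i j : ℕ} {d : St M.Q × ℕ × ℕ} (hs : CStep M x y (.sim q, i, j) d)
    (hj : j ≤ i) (hc : i - j ≤ nx i) :
    ∃ q' i' j', d = (.sim q', i', j') ∧ i < i' ∧ j < j' ∧ j' ≤ i' ∧ i' - j' ≤ nx i' ∧
      ((nx i' = nx i ∧ (q', i' - j') = (q, i - j)) ∨
       (nx i' = nx i + 1 ∧ M.Step ((x (mk (nx i))).getD z) (q, i - j) (q', i' - j'))) := by
  have hmark : ∀ a, x i = some a → ∃ k, i = mk k := by
    intro a ha
    obtain ⟨k, hk⟩ := (h.marker_x i).1 (by simp [ha])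
    exact ⟨k, hk.symm⟩
  cases hs with
  | idle _ _ _ hx =>
    have hne : i ≠ mk (nx i) := by
      intro e
      exact (h.marker_x i).2 ⟨_, e.symm⟩ hx
    refine ⟨q, i+1, j+1, rfl, by omega, by omega, by omega, ?_, Or.inl ⟨nx_succ hne, ?_⟩⟩
    · rw [nx_succ hne]; omega
    · simp
  | keep _ _ _ q' a hx ht =>
    obtain ⟨k, rfl⟩ := hmark a hx
    rw [nx_mk] at hc ⊢
    refine ⟨q', _, _, rfl, by omega, by omega, by omega, ?_, Or.inr ⟨nx_mk_add_one k, 0, ?_, ?_⟩⟩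
    · rw [nx_mk_add_one]; omega
    · rw [h.test hc (by omega)] at ht
      simpa [hx] using ht
    · simp
  | inc _ _ _ q' a hx ht =>
    obtain ⟨k, rfl⟩ := hmark a hx
    rw [nx_mk] at hc ⊢
    refine ⟨q', _, _, rfl, by omega, by omega, by omega, ?_, Or.inr ⟨nx_mk_add_two k, 1, ?_, ?_⟩⟩
    · rw [nx_mk_add_two]; omega
    · rw [h.test hc (by omega)] at ht
      simpa [hx] using ht
    · simp only; omega
  | dec _ _ _ q' a hx ht =>
    obtain ⟨k, rfl⟩ := hmark a hx
    rw [nx_mk] at hc ⊢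
    rw [h.test hc (show mk k = j + (mk k - j) by omega)] at ht
    have hpos : mk k - j ≠ 0 := by
      intro e
      have := M.transZero _ ht (by simp [e])
      simp at this
    refine ⟨q', _, _, rfl, by omega, by omega, by omega, ?_, Or.inr ⟨nx_mk_add_one k, -1, ?_, ?_⟩⟩
    · rw [nx_mk_add_one]; omega
    · simpa [hx] using ht
    · simp only; omega

lemma accepts_of_aut {σ : Type u} [Finite σ] {M : OneCounterBuchi σ} {x y : ℕ → Option σ}
    (h : Good x y) (z : σ) (hacc : (autT M).Accepts x y) :
    M.Accepts (fun k => (x (mk k)).getD z) := by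
  rw [TwoTapeBuchi.accepts_iff] at hacc
  obtain ⟨c, hc, hacc⟩ := hacc.tail
  replace hc : CStep M x y (.start, 0, 0) c := cstep_of_stepC _ _ _ _ _ hc
  obtain ⟨ρ, hρ0, hρ, ⟨qf, hqf, hinf⟩, hiN, hjN⟩ := hacc
  replace hρ : ∀ n, CStep M x y (ρ n) (ρ (n+1)) := fun n => cstep_of_stepC _ _ _ _ _ (hρ n)
  cases hc with
  | bad0 _ _ hb => exact absurd h.1 hb
  | toChk1 =>
    exfalso
    have : ∀ n, ∃ i, ρ n = (.chk1, i, i) := by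
      intro n
      induction n with
      | zero => exact ⟨0, hρ0⟩
      | succ n ih =>
        obtain ⟨i, hi⟩ := ih
        have hst := hρ n
        rw [hi] at hst
        generalize hd : ρ (n+1) = d at hst
        cases hst with
        | loop1 => exact ⟨i+1, rfl⟩
        | bad1 _ _ hb => exact absurd (h.2.1 i) hb
    obtain ⟨m, _, hm⟩ := hinf 0
    obtain ⟨i, hi⟩ := this m
    rw [hi] at hm
    rcases hqf with rfl | ⟨q, _, rfl⟩ <;> cases hm
  | toChk2 =>
    exfalso
    have : ∀ n, ∃ i, ρ n = (.chk2, i, 2*i+2) := by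
      intro n
      induction n with
      | zero => exact ⟨0, hρ0⟩
      | succ n ih =>
        obtain ⟨i, hi⟩ := ih
        have hst := hρ n
        rw [hi] at hst
        generalize hd : ρ (n+1) = d at hst
        cases hst with
        | loop2 => exact ⟨i+1, rfl⟩
        | bad2 _ _ hb => exact absurd (h.2.2 i) hb
    obtain ⟨m, _, hm⟩ := hinf 0
    obtain ⟨i, hi⟩ := this m
    rw [hi] at hm
    rcases hqf with rfl | ⟨q, _, rfl⟩ <;> cases hm
  | toSim =>
    have hsim : ∀ n, ∃ q i j, ρ n = (.sim q, i, j) ∧ j ≤ i ∧ i - j ≤ nx i := by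
      intro n
      induction n with
      | zero => exact ⟨M.init, 0, 0, hρ0, le_rfl, by simp⟩
      | succ n ih =>
        obtain ⟨q, i, j, hq, hji, hb⟩ := ih
        have hst := hρ n
        rw [hq] at hst
        obtain ⟨q', i', j', e, _, _, h1, h2, _⟩ := sim_step h z hst hji hb
        exact ⟨q', i', j', e, h1, h2⟩
    choose q i j hq hji hb using hsim
    have h00 : (St.sim (q 0), i 0, j 0) = (St.sim M.init, 0, 0) := (hq 0).symm.trans hρ0
    simp only [Prod.mk.injEq, St.sim.injEq] at h00
    obtain ⟨hq0, hi0, hj0⟩ := h00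
    have hk : ∀ n, (nx (i (n+1)) = nx (i n) ∧ (q (n+1), i (n+1) - j (n+1)) = (q n, i n - j n)) ∨
       (nx (i (n+1)) = nx (i n) + 1 ∧
        M.Step ((x (mk (nx (i n)))).getD z) (q n, i n - j n) (q (n+1), i (n+1) - j (n+1))) := by
      intro n
      have hst := hρ n
      rw [hq n, hq (n+1)] at hst
      obtain ⟨q', i', j', e, _, _, _, _, h3⟩ := sim_step h z hst (hji n) (hb n)
      replace e : (St.sim (q (n+1)), i (n+1), j (n+1)) = (St.sim q', i', j') := e
      simp only [Prod.mk.injEq, St.sim.injEq] at e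
      obtain ⟨rfl, rfl, rfl⟩ := e
      exact h3
    have hkN : ∀ N, ∃ n, N ≤ nx (i n) := by
      intro N
      obtain ⟨n, hn⟩ := hiN (mk N)
      rw [hq n] at hn
      exact ⟨n, by rw [← nx_mk N]; exact nx_mono hn⟩
    obtain ⟨r, hr, hrs⟩ := stutter (k := fun n => nx (i n)) (R := fun n => (q n, i n - j n))
      (P := fun m => M.Step ((x (mk m)).getD z)) (by simp [hi0, nx_zero]) hk hkN
    have hmono : Monotone (fun n => nx (i n)) :=
      monotone_nat_of_le_succ (fun n => by rcases hk n with h | h <;> omega)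
    obtain ⟨qa, hqa, rfl⟩ : ∃ qa ∈ M.acc, qf = St.sim qa := by
      rcases hqf with rfl | hh
      · obtain ⟨m, _, hm⟩ := hinf 0
        rw [hq m] at hm
        cases hm
      · exact hh
    refine ⟨r, ?_, hrs, qa, hqa, fun N => ?_⟩
    · have := hr 0
      simpa [hi0, hq0, hj0, nx_zero] using this
    · obtain ⟨n, hn⟩ := hkN N
      obtain ⟨m, hm, hmq⟩ := hinf n
      refine ⟨nx (i m), hn.trans (hmono hm), ?_⟩
      rw [hr m]
      rw [hq m] at hmq
      exact St.sim.inj hmq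

/-- position of head 1 in the simulating run -/
noncomputable def headPos {Q : Type u} (r : ℕ → Q × ℕ) : ℕ → ℕ
  | 0 => 0
  | n+1 =>
    if (headPos r n = mk (nx (headPos r n)) ∧
        (r (nx (headPos r n) + 1)).2 = (r (nx (headPos r n))).2 + 1)
    then headPos r n + 2 else headPos r n + 1

lemma aut_of_accepts {σ : Type u} [Finite σ] {M : OneCounterBuchi σ} {x y : ℕ → Option σ}
    (h : Good x y) (z : σ) (hacc : M.Accepts (fun k => (x (mk k)).getD z)) :
    (autT M).Accepts x y := by
  rw [TwoTapeBuchi.accepts_iff]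
  refine TwoTapeBuchi.AccFrom.cons (c' := (St.sim M.init, 0, 0)) ?_
    (stepC_of_cstep _ _ _ _ _ (CStep.toSim 0 0))
  obtain ⟨r, hr0, hr, qf, hqf, hinf⟩ := hacc
  have hcount : ∀ k, (r k).2 ≤ k := by
    intro k
    induction k with
    | zero => simp [hr0]
    | succ k ih =>
      obtain ⟨j, ht, hj⟩ := hr k
      have := M.transMoves _ ht
      simp only at this
      omega
  have key : ∀ n, (r (nx (headPos r n))).2 ≤ headPos r n →
      (CStep M x y (.sim (r (nx (headPos r n))).1, headPos r n, headPos r n - (r (nx (headPos r n))).2)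
        (.sim (r (nx (headPos r (n+1)))).1, headPos r (n+1), headPos r (n+1) - (r (nx (headPos r (n+1)))).2) ∧
      (r (nx (headPos r (n+1)))).2 ≤ headPos r (n+1) ∧
      (nx (headPos r (n+1)) = nx (headPos r n) ∨ nx (headPos r (n+1)) = nx (headPos r n) + 1) ∧
      headPos r n - (r (nx (headPos r n))).2 + 1 ≤ headPos r (n+1) - (r (nx (headPos r (n+1)))).2) := by
    intro n hle
    generalize hi : headPos r n = i at hle
    by_cases hm : i = mk (nx i)
    · generalize hk : nx i = k at hm hle
      subst hm
      obtain ⟨j, ht, hj⟩ := hr k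
      have hmv := M.transMoves _ ht
      simp only at hmv ht
      have htest := h.test (hcount k) (show mk k = (mk k - (r k).2) + (r k).2 by omega)
      rw [← htest] at ht
      have hx := good_x h z k
      rcases hmv with rfl | rfl | rfl
      · have hp : headPos r (n+1) = mk k + 1 := by
          rw [headPos, hi, nx_mk, if_neg]; rintro ⟨_, hh⟩; omega
        rw [hp, nx_mk_add_one]
        have e : mk k + 1 - (r (k+1)).2 = mk k - (r k).2 + 2 := by omega
        refine ⟨?_, by omega, Or.inr rfl, by omega⟩
        rw [e]
        exact CStep.dec _ _ _ _ _ hx ht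
      · have hp : headPos r (n+1) = mk k + 1 := by
          rw [headPos, hi, nx_mk, if_neg]; rintro ⟨_, hh⟩; omega
        rw [hp, nx_mk_add_one]
        have e : mk k + 1 - (r (k+1)).2 = mk k - (r k).2 + 1 := by omega
        refine ⟨?_, by omega, Or.inr rfl, by omega⟩
        rw [e]
        exact CStep.keep _ _ _ _ _ hx ht
      · have hp : headPos r (n+1) = mk k + 2 := by
          rw [headPos, hi, nx_mk, if_pos]; exact ⟨rfl, by omega⟩
        rw [hp, nx_mk_add_two]
        have e : mk k + 2 - (r (k+1)).2 = mk k - (r k).2 + 1 := by omega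
        refine ⟨?_, by omega, Or.inr rfl, by omega⟩
        rw [e]
        exact CStep.inc _ _ _ _ _ hx ht
    · have hp : headPos r (n+1) = i + 1 := by
        rw [headPos, hi, if_neg]; rintro ⟨hh, _⟩; exact hm hh
      rw [hp, nx_succ hm]
      have e : i + 1 - (r (nx i)).2 = i - (r (nx i)).2 + 1 := by omega
      refine ⟨?_, by omega, Or.inl rfl, by omega⟩
      rw [e]
      refine CStep.idle _ _ _ ?_
      by_contra hne
      obtain ⟨k, hk⟩ := (h.marker_x i).1 hne
      apply hm
      rw [← hk, nx_mk]
  have hp0 : headPos r 0 = 0 := rfl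
  have hle : ∀ n, (r (nx (headPos r n))).2 ≤ headPos r n := by
    intro n
    induction n with
    | zero => simp [hp0, nx_zero, hr0]
    | succ n ih => exact (key n ih).2.1
  have hjge : ∀ n, n ≤ headPos r n - (r (nx (headPos r n))).2 := by
    intro n
    induction n with
    | zero => simp
    | succ n ih => have := (key n (hle n)).2.2.2; omega
  have hks := fun n => (key n (hle n)).2.2.1
  have hkN : ∀ N, ∃ n, N ≤ nx (headPos r n) := by
    intro N
    refine ⟨mk N, ?_⟩
    have := hjge (mk N)
    rw [← nx_mk N]
    refine nx_mono ?_
    rw [nx_mk]; omega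
  have hmono : Monotone (fun n => nx (headPos r n)) :=
    monotone_nat_of_le_succ (fun n => by have := hks n; omega)
  refine ⟨fun n => (.sim (r (nx (headPos r n))).1, headPos r n, headPos r n - (r (nx (headPos r n))).2), ?_,
    fun n => stepC_of_cstep _ _ _ _ _ (key n (hle n)).1, ⟨.sim qf, Or.inr ⟨qf, hqf, rfl⟩, ?_⟩,
    fun N => ⟨N, ?_⟩, fun N => ⟨N, hjge N⟩⟩
  · simp [hp0, nx_zero, hr0]
  · intro N
    obtain ⟨m, hm, hmq⟩ := hinf (nx (headPos r N) + 1)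
    obtain ⟨n, hn, _⟩ := reach (k := fun n => nx (headPos r n)) (by simp [hp0, nx_zero]) hks hkN m
    refine ⟨n, ?_, ?_⟩
    · by_contra hlt
      have := hmono (show n ≤ N by omega)
      simp only at this hn
      omega
    · simp only [hn, hmq]; rfl
  · have := hjge N
    simp only
    omega

/-! ### Topology -/

lemma pi_union_open {X : Type u} [TopologicalSpace X]
    (hX : ∀ O : Set X, IsOpen O → ∃ F : ℕ → Set X, (∀ n, IsClosed (F n)) ∧ O = ⋃ n, F n)
    (γ : Ordinal.{0}) (hγ : 2 ≤ γ) (E O : Set X)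
    (hE : E ∈ SigmaPi X γ false) (hO : IsOpen O) : E ∪ O ∈ SigmaPi X γ false := by
  have h12 : (1 : Ordinal) < 2 := one_lt_two
  have hγ1 : γ ≠ 1 := (h12.trans_le hγ).ne'
  rw [SigmaPi] at hE ⊢
  simp only [hγ1, false_and, ne_eq, not_false_eq_true, true_and, false_or, Set.mem_setOf_eq,
    Bool.not_false, Bool.false_eq_true, if_false] at hE ⊢
  obtain ⟨f, hf, rfl⟩ := hE
  refine ⟨fun n => f n ∪ O, fun n => ?_, ?_⟩
  · obtain ⟨δ, hδ, hfn⟩ := hf n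
    refine ⟨δ, hδ, ?_⟩
    rw [SigmaPi] at hfn ⊢
    rcases hfn with ⟨rfl, h⟩ | ⟨hδ1, g, hg, hfg⟩
    · left
      simp only [true_and, Bool.true_eq_false, false_and, or_false] at h ⊢
      exact h.union hO
    · right
      refine ⟨hδ1, ?_⟩
      simp only [if_true, Bool.not_true] at hfg hg ⊢
      obtain ⟨F, hF, rfl⟩ := hX O hO
      have h1δ : 1 < δ := by
        refine lt_of_le_of_ne ?_ (Ne.symm hδ1)
        obtain ⟨ε, hε, _⟩ := hg 0
        exact Order.one_le_iff_pos.2 (lt_of_le_of_lt zero_le hε)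
      refine ⟨fun m => if m % 2 = 0 then g (m / 2) else F (m / 2), fun m => ?_, ?_⟩
      · dsimp only
        split_ifs
        · exact hg _
        · refine ⟨1, h1δ, ?_⟩
          rw [SigmaPi]
          left
          simpa using hF _
      · rw [hfg]
        ext p
        simp only [Set.mem_union, Set.mem_iUnion]
        constructor
        · rintro (⟨m, hm⟩ | ⟨m, hm⟩)
          · exact ⟨2*m, by simpa using hm⟩
          · refine ⟨2*m+1, ?_⟩
            rw [if_neg (by omega), show (2*m+1)/2 = m by omega]
            exact hm
        · rintro ⟨m, hm⟩
          split_ifs at hm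
          · exact Or.inl ⟨_, hm⟩
          · exact Or.inr ⟨_, hm⟩
  · rw [Set.iInter_union]

lemma open_fsigma (Y : Type) [TopologicalSpace Y] [DiscreteTopology Y] (O : Set (ℕ → Y))
    (hO : IsOpen O) : ∃ F : ℕ → Set (ℕ → Y), (∀ n, IsClosed (F n)) ∧ O = ⋃ n, F n := by
  letI := TopologicalSpace.metrizableSpaceMetric (ℕ → Y)
  obtain ⟨F, h1, _, h2, _⟩ := hO.exists_iUnion_isClosed
  exact ⟨F, h1, h2.symm⟩

lemma good_closed (σ : Type) :
    IsClosed {w : ℕ → Option σ × Option σ | Good (fun n => (w n).1) (fun n => (w n).2)} := by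
  have c1 : ∀ i, Continuous (fun w : ℕ → Option σ × Option σ => (w i).1) := fun i => by fun_prop
  have c2 : ∀ i, Continuous (fun w : ℕ → Option σ × Option σ => (w i).2) := fun i => by fun_prop
  have key : ∀ (i j : ℕ) (P : Option σ → Option σ → Prop),
      IsClosed {w : ℕ → Option σ × Option σ | P (w i).1 (w j).2} := by
    intro i j P
    exact (isClosed_discrete {p : Option σ × Option σ | P p.1 p.2}).preimage
      ((c1 i).prodMk (c2 j))
  simp only [Good, Set.setOf_and, Set.setOf_forall]
  refine IsClosed.inter (IsClosed.inter ?_ ?_) (IsClosed.inter ?_ ?_)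
  · exact key 0 0 (fun _ b => b ≠ none)
  · exact key 0 1 (fun _ b => b = none)
  · exact isClosed_iInter fun i => key i i (fun a b => a ≠ none ↔ b ≠ none)
  · refine isClosed_iInter fun i => IsClosed.inter ?_ ?_
    · exact key i (2*i+2) (fun a b => a ≠ none ↔ b ≠ none)
    · exact key 0 (2*i+2+1) (fun _ b => b = none)

open Classical in
/-- the coding: the letter `x n` at position `mk n` -/
noncomputable def enc {σ : Type u} (x : ℕ → σ) (p : ℕ) : Option σ :=
  if p = mk (nx p) then some (x (nx p)) else none

lemma enc_mk {σ : Type u} (x : ℕ → σ) (k : ℕ) : enc x (mk k) = some (x k) := by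
  simp [enc, nx_mk]

lemma enc_ne_none {σ : Type u} (x : ℕ → σ) (p : ℕ) : enc x p ≠ none ↔ ∃ k, p = mk k := by
  constructor
  · intro h
    refine ⟨nx p, ?_⟩
    by_contra hc
    exact h (by simp [enc, hc])
  · rintro ⟨k, rfl⟩
    simp [enc_mk]

lemma good_enc {σ : Type u} (z : σ) (x : ℕ → σ) : Good (enc x) (enc (fun _ => z)) := by
  refine ⟨⟨(enc_ne_none _ _).2 ⟨0, rfl⟩, ?_⟩, ?_, ?_⟩
  · by_contra hc
    obtain ⟨k, hk⟩ := (enc_ne_none _ _).1 hc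
    cases k with
    | zero => rw [mk_zero] at hk; omega
    | succ k => rw [mk_succ] at hk; omega
  · intro i
    rw [enc_ne_none, enc_ne_none]
  · intro i
    constructor
    · rw [enc_ne_none, enc_ne_none]
      constructor
      · rintro ⟨k, rfl⟩
        exact ⟨k+1, (mk_succ k).symm⟩
      · rintro ⟨k, hk⟩
        cases k with
        | zero => rw [mk_zero] at hk; omega
        | succ k => rw [mk_succ] at hk; exact ⟨k, by omega⟩
    · by_contra hc
      obtain ⟨k, hk⟩ := (enc_ne_none _ _).1 hc
      cases k with
      | zero => rw [mk_zero] at hk; omega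
      | succ k => rw [mk_succ] at hk; omega

lemma enc_continuous (σ : Type) [TopologicalSpace σ] [DiscreteTopology σ] :
    Continuous (enc : (ℕ → σ) → ℕ → Option σ) := by
  refine continuous_pi fun p => ?_
  by_cases hp : p = mk (nx p)
  · simp only [enc, if_pos hp]
    exact (continuous_of_discreteTopology (f := (some : σ → Option σ))).comp (continuous_apply _)
  · simp only [enc, if_neg hp]
    exact continuous_const

/-- For a countable ordinal `γ ≥ 2`: if some `Π⁰_γ`-complete
`L ⊆ Σ^ω` is accepted by a real-time Büchi 1-counter automaton, then some
infinitary rational relation `R ⊆ Γ^ω × Γ^ω` (with `Γ = Σ ∪ {A}`), regarded as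
an ω-language over the product alphabet `Γ × Γ`, is `Π⁰_γ`-complete. -/
theorem exists_piComplete_ratRel (σ : Type) [Fintype σ] [Nonempty σ]
    [TopologicalSpace σ] [DiscreteTopology σ] (z : σ)
    (γ : Ordinal.{0}) (hγ : 2 ≤ γ) (hcount : γ.card ≤ Cardinal.aleph0)
    (hex : ∃ (L : Set (ℕ → σ)) (M : OneCounterBuchi σ),
      L = {x | M.Accepts x} ∧ IsCompleteFor false γ L) :
    ∃ R : Set ((ℕ → Option σ) × (ℕ → Option σ)),
      IsRatRel R ∧ IsCompleteFor false γ
        {w : ℕ → Option σ × Option σ | (fun n => (w n).1, fun n => (w n).2) ∈ R} := by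
  obtain ⟨L, M, rfl, hL⟩ := hex
  refine ⟨{p | (autT M).Accepts p.1 p.2}, ⟨autT M, fun p => Iff.rfl⟩, ?_⟩
  have hgood : ∀ x y : ℕ → Option σ, Good x y →
      ((autT M).Accepts x y ↔ M.Accepts (fun k => (x (mk k)).getD z)) :=
    fun x y h => ⟨accepts_of_aut h z, aut_of_accepts h z⟩
  intro Y hY hYn E
  letI : TopologicalSpace Y := ⊥
  haveI : DiscreteTopology Y := ⟨rfl⟩
  have hLE := hL Y hY hYn
  constructor
  · intro hE
    obtain ⟨f, hf, rfl⟩ := (hLE E).1 hE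
    refine ⟨fun t n => (enc (f t) n, enc (fun _ => z) n), ?_, ?_⟩
    · refine continuous_pi fun n => Continuous.prodMk ?_ continuous_const
      exact (continuous_apply n).comp ((enc_continuous σ).comp hf)
    · ext t
      simp only [Set.mem_preimage, Set.mem_setOf_eq]
      have := hgood _ _ (good_enc z (f t))
      simp only [enc_mk, Option.getD_some] at this
      exact this.symm
  · rintro ⟨f, hf, rfl⟩
    let dec : (ℕ → Option σ × Option σ) → (ℕ → σ) := fun w k => ((w (mk k)).1).getD z
    have hdec : Continuous dec := by
      refine continuous_pi fun k => ?_
      exact (continuous_of_discreteTopology (f := fun o : Option σ => o.getD z)).comp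
        (continuous_fst.comp (continuous_apply (mk k)))
    have h1 := (hLE ((dec ∘ f) ⁻¹' {x | M.Accepts x})).2 ⟨dec ∘ f, hdec.comp hf, rfl⟩
    have h2 := pi_union_open (open_fsigma Y) γ hγ _ _ h1 ((good_closed σ).preimage hf).isOpen_compl
    convert h2 using 1
    ext t
    simp only [Set.mem_preimage, Set.mem_setOf_eq, Set.mem_union, Set.mem_compl_iff]
    by_cases hg : Good (fun n => (f t n).1) (fun n => (f t n).2)
    · simp only [hg, not_true_eq_false, or_false]
      exact hgood _ _ hg
    · simp only [hg, not_false_eq_true, or_true, iff_true]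
      exact accepts_of_not_good M _ _ hg
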